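/- Let ℂⁿ = H_S ⊕ H_R be an orthogonal decomposition with orthogonal projections Π_S and Π_R = I − Π_S. Let H ∈ M_n(ℂ) be Hermitian and L_1, …, L_r ∈ M_n(ℂ) satisfy Π_R L_k Π_S = 0 for every k and Π_S (i·H − (1/2)·Σ_k L_k† L_k) Π_R = 0. Then for every Hermitian matrix ρ ∈ M_n(ℂ), trace(Π_R · 𝓛(ρ)) = −trace((Σ_k Π_R L_k† Π_S L_k Π_R) · (Π_R ρ Π_R)); in particular, if ρ is positive semidefinite then trace(Π_R · 𝓛(ρ)) ≤ 0. -/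

import Mathlib

open scoped Matrix ComplexOrder

noncomputable section

attribute [local instance] Matrix.normedAddCommGroup Matrix.normedSpace

abbrev Mat (n : ℕ) := Matrix (Fin n) (Fin n) ℂ

/-- The Lindblad generator `𝓛(ρ) = −i[H,ρ] + Σ_k (L_k ρ L_k† − ½(L_k† L_k ρ + ρ L_k† L_k))`. -/
def lindblad {n r : ℕ} (H : Mat n) (L : Fin r → Mat n) : Mat n →ₗ[ℂ] Mat n :=
  (-Complex.I) • (LinearMap.mulLeft ℂ H - LinearMap.mulRight ℂ H)
    + ∑ k, ((LinearMap.mulRight ℂ (L k)ᴴ).comp (LinearMap.mulLeft ℂ (L k))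
        - (1/2 : ℂ) • (LinearMap.mulLeft ℂ ((L k)ᴴ * L k)
            + LinearMap.mulRight ℂ ((L k)ᴴ * L k)))

/-- `evol H L t ρ = exp (t 𝓛) ρ`, the solution of the master equation at time `t`. -/
def evol {n r : ℕ} (H : Mat n) (L : Fin r → Mat n) (t : ℝ) (ρ : Mat n) : Mat n :=
  haveI : IsTopologicalRing (Mat n →L[ℂ] Mat n) :=
    @NonUnitalSeminormedRing.toIsTopologicalRing _ (ContinuousLinearMap.toNormedRing
      (𝕜 := ℂ) (E := Mat n)).toNonUnitalNormedRing.toNonUnitalSeminormedRing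
  NormedSpace.exp ((t : ℂ) • (lindblad H L).toContinuousLinearMap) ρ

/-- The trace of `A * 𝓛(ρ)` is the trace of `𝓛†(A) * ρ`, with `𝓛†` the Heisenberg-picture
generator. -/
theorem trace_mul_lindblad {n r : ℕ} (A H : Mat n) (L : Fin r → Mat n) (ρ : Mat n) :
    (A * lindblad H L ρ).trace =
      ((Complex.I • (H * A - A * H) + (∑ k, (L k)ᴴ * A * L k
        - (1/2 : ℂ) • (A * ∑ k, (L k)ᴴ * L k)
        - (1/2 : ℂ) • ((∑ k, (L k)ᴴ * L k) * A))) * ρ).trace := by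
  have hH : (A * (ρ * H)).trace = (H * A * ρ).trace := by
    rw [← Matrix.mul_assoc, Matrix.trace_mul_comm, Matrix.mul_assoc]
  have hL (k : Fin r) : (A * (L k * ρ * (L k)ᴴ)).trace = ((L k)ᴴ * A * L k * ρ).trace := by
    rw [← Matrix.mul_assoc, Matrix.trace_mul_comm]
    simp only [Matrix.mul_assoc]
  have hLL (k : Fin r) :
      (A * (ρ * ((L k)ᴴ * L k))).trace = ((L k)ᴴ * L k * A * ρ).trace := by
    rw [← Matrix.mul_assoc, Matrix.trace_mul_comm, ← Matrix.mul_assoc]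
  simp only [lindblad, LinearMap.add_apply, LinearMap.smul_apply, LinearMap.sub_apply,
    LinearMap.sum_apply, LinearMap.comp_apply, LinearMap.mulLeft_apply, LinearMap.mulRight_apply,
    mul_add, mul_sub, add_mul, sub_mul, Finset.mul_sum, Finset.sum_mul, Matrix.mul_smul,
    Matrix.smul_mul, Matrix.trace_add, Matrix.trace_sub, Matrix.trace_smul, Matrix.trace_sum,
    hH, hL, hLL, smul_add, smul_sub, smul_eq_mul, Finset.sum_add_distrib, Finset.sum_sub_distrib]
  simp only [← Matrix.mul_assoc]
  ring

/-- Under the invariance conditions, the Heisenberg-picture generator sends `Π_R` to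
`-Σ_k Π_R L_k† Π_S L_k Π_R`. -/
theorem heisenberg_one_sub_projection {n r : ℕ}
    (PS : Mat n) (hPH : PS.IsHermitian)
    (H : Mat n) (hH : H.IsHermitian) (L : Fin r → Mat n)
    (hLQ : ∀ k, (1 - PS) * L k * PS = 0)
    (hinv : PS * (Complex.I • H - (1/2 : ℂ) • ∑ k, (L k)ᴴ * L k) * (1 - PS) = 0) :
    Complex.I • (H * (1 - PS) - (1 - PS) * H) + (∑ k, (L k)ᴴ * (1 - PS) * L k
        - (1/2 : ℂ) • ((1 - PS) * ∑ k, (L k)ᴴ * L k)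
        - (1/2 : ℂ) • ((∑ k, (L k)ᴴ * L k) * (1 - PS))) =
      -∑ k, (1 - PS) * (L k)ᴴ * PS * L k * (1 - PS) := by
  have hRH : (1 - PS)ᴴ = 1 - PS := by simp [hPH.eq]
  have hsum : ∑ k, (L k)ᴴ * (1 - PS) * L k =
      (1 - PS) * (∑ k, (L k)ᴴ * L k) * (1 - PS)
        - ∑ k, (1 - PS) * (L k)ᴴ * PS * L k * (1 - PS) := by
    rw [Finset.mul_sum, Finset.sum_mul, ← Finset.sum_sub_distrib]
    refine Finset.sum_congr rfl fun k _ => ?_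
    have hadj : PS * (L k)ᴴ * (1 - PS) = 0 := by
      have h := congrArg Matrix.conjTranspose (hLQ k)
      simpa only [Matrix.conjTranspose_mul, hRH, hPH.eq, Matrix.conjTranspose_zero,
        ← Matrix.mul_assoc] using h
    have hright : (1 - PS) * L k * (1 - PS) = (1 - PS) * L k := by
      rw [mul_sub, hLQ k, mul_one, sub_zero]
    have hleft : (1 - PS) * (L k)ᴴ * (1 - PS) = (L k)ᴴ * (1 - PS) := by
      rw [sub_mul, sub_mul, hadj, one_mul, sub_zero]
    calc (L k)ᴴ * (1 - PS) * L k = (1 - PS) * (L k)ᴴ * (1 - PS) * L k * (1 - PS) := by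
          rw [hleft]
          simp only [Matrix.mul_assoc] at hright ⊢
          rw [hright]
      _ = _ := by noncomm_ring
  have hG : (∑ k, (L k)ᴴ * L k)ᴴ = ∑ k, (L k)ᴴ * L k := by
    simp [Matrix.conjTranspose_sum]
  rw [hsum]
  generalize (∑ k, (L k)ᴴ * L k) = G at *
  generalize (∑ k, (1 - PS) * (L k)ᴴ * PS * L k * (1 - PS)) = M at *
  generalize hK : Complex.I • H - (1/2 : ℂ) • G = K at *
  have hKadj : Kᴴ = -(Complex.I • H) - (1/2 : ℂ) • G := by
    simp [← hK, hG, hH.eq]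
  have hKR : K * (1 - PS) = (1 - PS) * K * (1 - PS) := by
    rw [sub_mul 1 PS K, sub_mul, hinv, one_mul, sub_zero]
  have hRK : (1 - PS) * Kᴴ = (1 - PS) * Kᴴ * (1 - PS) := by
    have h := congrArg Matrix.conjTranspose hKR
    simpa only [Matrix.conjTranspose_mul, hRH, ← Matrix.mul_assoc] using h
  have hKG : K + Kᴴ = -G := by
    rw [hKadj, ← hK]
    module
  calc _ = K * (1 - PS) + (1 - PS) * Kᴴ + (1 - PS) * G * (1 - PS) - M := by
        rw [hKadj, ← hK]
        simp only [sub_mul _ _ (1 - PS), mul_sub (1 - PS), mul_neg, Matrix.smul_mul,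
          Matrix.mul_smul]
        module
    _ = (1 - PS) * (K + Kᴴ) * (1 - PS) + (1 - PS) * G * (1 - PS) - M := by
        rw [hKR, hRK, mul_add, add_mul]
    _ = -M := by
        rw [hKG, mul_neg, neg_mul, neg_add_cancel, zero_sub]

/-- Under the invariance conditions for `H_S`, for every Hermitian `ρ`
`tr(Π_R 𝓛(ρ)) = −tr((Σ_k Π_R L_k† Π_S L_k Π_R)(Π_R ρ Π_R))`; in particular it is `≤ 0`
for positive semidefinite `ρ`. -/
theorem lindblad_trace_R_formula {n r : ℕ}
    (PS : Mat n) (hPH : PS.IsHermitian) (hPidem : PS * PS = PS)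
    (H : Mat n) (hH : H.IsHermitian) (L : Fin r → Mat n)
    (hLQ : ∀ k, (1 - PS) * L k * PS = 0)
    (hinv : PS * (Complex.I • H - (1/2 : ℂ) • ∑ k, (L k)ᴴ * L k) * (1 - PS) = 0) :
    (∀ ρ : Mat n, ρ.IsHermitian →
      ((1 - PS) * lindblad H L ρ).trace =
        -((∑ k, (1 - PS) * (L k)ᴴ * PS * L k * (1 - PS)) *
            ((1 - PS) * ρ * (1 - PS))).trace) ∧
    (∀ ρ : Mat n, ρ.PosSemidef → ((1 - PS) * lindblad H L ρ).trace ≤ 0) := by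
  have hformula (ρ : Mat n) : ((1 - PS) * lindblad H L ρ).trace =
      -((∑ k, (1 - PS) * (L k)ᴴ * PS * L k * (1 - PS)) * ρ).trace := by
    rw [trace_mul_lindblad, heisenberg_one_sub_projection PS hPH H hH L hLQ hinv, neg_mul,
      Matrix.trace_neg]
  have hRH : (1 - PS)ᴴ = 1 - PS := by simp [hPH.eq]
  have hRR : (1 - PS) * (1 - PS) = 1 - PS := (show IsIdempotentElem PS from hPidem).one_sub
  refine ⟨fun ρ _ => ?_, fun ρ hρ => ?_⟩
  · have hcompress (M : Mat n) : (M * ((1 - PS) * ρ * (1 - PS))).trace =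
        ((1 - PS) * M * (1 - PS) * ρ).trace := by
      rw [← Matrix.mul_assoc, Matrix.trace_mul_comm]
      simp only [Matrix.mul_assoc]
    rw [hformula, hcompress]
    simp only [Finset.mul_sum, Finset.sum_mul, ← Matrix.mul_assoc, hRR]
    simp only [Matrix.mul_assoc _ (1 - PS) (1 - PS), hRR]
  · rw [hformula, neg_nonpos, Finset.sum_mul, Matrix.trace_sum]
    refine Finset.sum_nonneg fun k _ => ?_
    have hfactor : (PS * L k * (1 - PS))ᴴ * (PS * L k * (1 - PS)) =
        (1 - PS) * (L k)ᴴ * PS * L k * (1 - PS) := by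
      simp only [Matrix.conjTranspose_mul, hRH, hPH.eq, Matrix.mul_assoc]
      rw [← Matrix.mul_assoc PS PS, hPidem]
    have h := (hρ.mul_mul_conjTranspose_same (PS * L k * (1 - PS))).trace_nonneg
    rwa [Matrix.trace_mul_comm, ← Matrix.mul_assoc, hfactor] at h
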